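/- Let 𝒦 ⊆ ℝ^d be a convex body with centroid μ and covariance matrix Σ. Then the ellipsoid {x : ‖x − μ‖_{Σ⁻¹} ≤ √((d+2)/d)} is contained in 𝒦, and 𝒦 is contained in the ellipsoid {x : ‖x − μ‖_{Σ⁻¹} ≤ √(d(d+2))}. -/

import Mathlib

open Set MeasureTheory

lemma bm1_compact {A B C : Set ℝ} (hA : IsCompact A) (hB : IsCompact B)
    (hAn : A.Nonempty) (hBn : B.Nonempty) (h : ∀ a ∈ A, ∀ b ∈ B, a + b ∈ C) :
    volume A + volume B ≤ volume C := by
  obtain ⟨α, hα, hαm⟩ := hA.exists_isGreatest hAn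
  obtain ⟨β, hβ, hβm⟩ := hB.exists_isLeast hBn
  have e1 : volume ((fun x => x + β) '' A) = volume A := by
    rw [Set.image_add_right]; exact measure_preimage_add_right _ _ _
  have e2 : volume ((fun x => α + x) '' B) = volume B := by
    rw [Set.image_add_left]; exact measure_preimage_add _ _ _
  have hd : AEDisjoint volume ((fun x => x + β) '' A) ((fun x => α + x) '' B) := by
    apply measure_mono_null (t := {α + β}) _ (by simp)
    rintro x ⟨⟨a, ha, rfl⟩, ⟨b, hb, hx⟩⟩
    have h1 := hαm ha
    have h2 := hβm hb
    simp only [mem_singleton_iff] at *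
    linarith
  have hm : NullMeasurableSet ((fun x => α + x) '' B) volume :=
    (hB.image (by fun_prop)).measurableSet.nullMeasurableSet
  rw [← e1, ← e2, ← measure_union₀ hm hd]
  apply measure_mono
  rintro x (⟨a, ha, rfl⟩ | ⟨b, hb, rfl⟩)
  · exact h a ha β hβ
  · exact h α hα b hb

lemma bm1 {A B C : Set ℝ} (hA : MeasurableSet A) (hB : MeasurableSet B)
    (hAn : A.Nonempty) (hBn : B.Nonempty) (h : ∀ a ∈ A, ∀ b ∈ B, a + b ∈ C) :
    volume A + volume B ≤ volume C := by
  obtain ⟨a, ha⟩ := hAn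
  obtain ⟨b, hb⟩ := hBn
  rw [hA.measure_eq_iSup_isCompact, hB.measure_eq_iSup_isCompact]
  simp only [iSup_and']
  apply ENNReal.biSup_add_biSup_le' ⟨∅, by simp⟩ ⟨∅, by simp⟩
  rintro A' ⟨hA', cA⟩ B' ⟨hB', cB⟩
  have := bm1_compact (C := C) (cA.insert a) (cB.insert b) (insert_nonempty _ _)
    (insert_nonempty _ _) (fun x hx y hy => h x (insert_subset ha hA' hx) y
      (insert_subset hb hB' hy))
  exact le_trans (add_le_add (measure_mono (subset_insert _ _))
    (measure_mono (subset_insert _ _))) this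

lemma bm1_conv {A B C : Set ℝ} {l : ℝ} (h0 : 0 < l) (h1 : l < 1)
    (hA : MeasurableSet A) (hB : MeasurableSet B)
    (hAn : A.Nonempty) (hBn : B.Nonempty) (h : ∀ a ∈ A, ∀ b ∈ B, (1 - l) * a + l * b ∈ C) :
    ENNReal.ofReal (1 - l) * volume A + ENNReal.ofReal l * volume B ≤ volume C := by
  have key : ∀ (c : ℝ) (S : Set ℝ), 0 < c → volume ((fun x => c⁻¹ * x) ⁻¹' S) =
      ENNReal.ofReal c * volume S := by
    intro c S hc
    rw [Real.volume_preimage_mul_left (inv_ne_zero hc.ne')]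
    rw [inv_inv, abs_of_pos hc]
  have hl : 0 < 1 - l := by linarith
  rw [← key _ A hl, ← key _ B h0]
  apply bm1
  · exact hA.preimage (by fun_prop)
  · exact hB.preimage (by fun_prop)
  · obtain ⟨a, ha⟩ := hAn
    exact ⟨(1 - l) * a, by simpa [inv_mul_cancel_left₀ hl.ne'] using ha⟩
  · obtain ⟨a, ha⟩ := hBn
    exact ⟨l * a, by simpa [inv_mul_cancel_left₀ h0.ne'] using ha⟩
  · intro a ha b hb
    have := h _ ha _ hb
    simpa [mul_inv_cancel_left₀ hl.ne', mul_inv_cancel_left₀ h0.ne'] using this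

lemma pl1_norm {f g h : ℝ → ℝ} {l : ℝ} (h0 : 0 < l) (h1 : l < 1)
    (mf : Measurable f) (mg : Measurable g) (mh : Measurable h)
    (pf : ∀ x, 0 ≤ f x) (pg : ∀ x, 0 ≤ g x) (ph : ∀ x, 0 ≤ h x)
    (intf : Integrable f) (intg : Integrable g) (inth : Integrable h)
    (sf : IsLUB (range f) 1) (sg : IsLUB (range g) 1)
    (H : ∀ x y, f x ^ (1 - l) * g y ^ l ≤ h ((1 - l) * x + l * y)) :
    (1 - l) * (∫ x, f x) + l * (∫ x, g x) ≤ ∫ x, h x := by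
  have hl : 0 < 1 - l := by linarith
  have lc : ∀ u : ℝ → ℝ, Measurable u → (∀ x, 0 ≤ u x) → Integrable u →
      ENNReal.ofReal (∫ x, u x) = ∫⁻ t in Ioi (0:ℝ), volume {x | t < u x} := by
    intro u mu pu iu
    rw [ofReal_integral_eq_lintegral_ofReal iu (Filter.Eventually.of_forall pu)]
    exact lintegral_eq_lintegral_meas_lt _ (Filter.Eventually.of_forall pu) mu.aemeasurable
  have am : ∀ u : ℝ → ℝ, Measurable (fun t : ℝ => volume {x | t < u x}) := by
    intro u
    apply Antitone.measurable
    intro s t hst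
    exact measure_mono (fun x hx => lt_of_le_of_lt hst hx)
  have nf : 0 ≤ ∫ x, f x := integral_nonneg pf
  have ng : 0 ≤ ∫ x, g x := integral_nonneg pg
  have nh : 0 ≤ ∫ x, h x := integral_nonneg ph
  rw [← ENNReal.ofReal_le_ofReal_iff nh, ENNReal.ofReal_add (by positivity) (by positivity),
    ENNReal.ofReal_mul hl.le, ENNReal.ofReal_mul h0.le, lc f mf pf intf, lc g mg pg intg,
    lc h mh ph inth, ← lintegral_const_mul _ (am f), ← lintegral_const_mul _ (am g),
    ← lintegral_add_left ((am f).const_mul _)]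
  apply setLIntegral_mono (am h)
  intro t ht
  have ht : 0 < t := ht
  rcases lt_or_ge t 1 with ht1 | ht1
  · obtain ⟨_, ⟨x, rfl⟩, hx⟩ := (lt_isLUB_iff sf).1 ht1
    obtain ⟨_, ⟨y, rfl⟩, hy⟩ := (lt_isLUB_iff sg).1 ht1
    apply bm1_conv h0 h1 (measurableSet_lt measurable_const mf)
      (measurableSet_lt measurable_const mg) ⟨x, hx⟩ ⟨y, hy⟩
    intro a ha b hb
    simp only [mem_ofPred_eq] at ha hb ⊢
    refine lt_of_lt_of_le ?_ (H a b)
    calc t = t ^ (1 - l) * t ^ l := by rw [← Real.rpow_add ht]; simp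
      _ < _ := by
        apply mul_lt_mul'' (Real.rpow_lt_rpow ht.le ha hl) (Real.rpow_lt_rpow ht.le hb h0) <;>
          positivity
  · have ef : {x | t < f x} = ∅ := by
      ext x; simpa using (sf.1 ⟨x, rfl⟩).trans ht1
    have eg : {x | t < g x} = ∅ := by
      ext x; simpa using (sg.1 ⟨x, rfl⟩).trans ht1
    simp [ef, eg]

lemma pl1 {f g h : ℝ → ℝ} {l : ℝ} (h0 : 0 < l) (h1 : l < 1)
    (mf : Measurable f) (mg : Measurable g) (mh : Measurable h)
    (pf : ∀ x, 0 ≤ f x) (pg : ∀ x, 0 ≤ g x) (ph : ∀ x, 0 ≤ h x)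
    (intf : Integrable f) (intg : Integrable g) (inth : Integrable h)
    (bf : BddAbove (range f)) (bg : BddAbove (range g))
    (H : ∀ x y, f x ^ (1 - l) * g y ^ l ≤ h ((1 - l) * x + l * y)) :
    (∫ x, f x) ^ (1 - l) * (∫ x, g x) ^ l ≤ ∫ x, h x := by
  have hl : 0 < 1 - l := by linarith
  have nf : 0 ≤ ∫ x, f x := integral_nonneg pf
  have ng : 0 ≤ ∫ x, g x := integral_nonneg pg
  have nh : 0 ≤ ∫ x, h x := integral_nonneg ph
  have aux : ∀ u : ℝ → ℝ, (∀ x, 0 ≤ u x) → BddAbove (range u) → (∫ x, u x) ≠ 0 →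
      ∃ a, 0 < a ∧ IsLUB (range fun x => a⁻¹ * u x) 1 := by
    intro u pu bu iu
    have hs := isLUB_csSup (range_nonempty u) bu
    have hpos : 0 < sSup (range u) := by
      by_contra hcon
      apply iu
      have : u = fun _ => 0 := by
        ext x
        exact le_antisymm ((hs.1 ⟨x, rfl⟩).trans (not_lt.1 hcon)) (pu x)
      simp [this]
    refine ⟨_, hpos, ?_, ?_⟩
    · rintro _ ⟨x, rfl⟩
      have := hs.1 ⟨x, rfl⟩
      simp only
      rw [inv_mul_le_iff₀ hpos]; simpa using this
    · intro b hb
      have : sSup (range u) ≤ sSup (range u) * b := by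
        apply hs.2
        rintro _ ⟨x, rfl⟩
        have := hb ⟨x, rfl⟩
        simp only at this
        rwa [inv_mul_le_iff₀ hpos] at this
      nlinarith
  rcases eq_or_ne (∫ x, f x) 0 with e | e
  · rw [e, Real.zero_rpow hl.ne', zero_mul]; exact nh
  rcases eq_or_ne (∫ x, g x) 0 with e' | e'
  · rw [e', Real.zero_rpow h0.ne', mul_zero]; exact nh
  obtain ⟨a, ha, sa⟩ := aux f pf bf e
  obtain ⟨b, hb, sb⟩ := aux g pg bg e'
  set c := a ^ (1 - l) * b ^ l with hc
  have hcp : 0 < c := by positivity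
  have key := pl1_norm (f := fun x => a⁻¹ * f x) (g := fun x => b⁻¹ * g x)
    (h := fun x => c⁻¹ * h x) h0 h1 (mf.const_mul _) (mg.const_mul _) (mh.const_mul _)
    (fun x => mul_nonneg (by positivity) (pf x)) (fun x => mul_nonneg (by positivity) (pg x))
    (fun x => mul_nonneg (by positivity) (ph x))
    (intf.const_mul _) (intg.const_mul _) (inth.const_mul _) sa sb (by
      intro x y
      rw [Real.mul_rpow (by positivity) (pf x), Real.mul_rpow (by positivity) (pg y),
        Real.inv_rpow ha.le, Real.inv_rpow hb.le]
      calc _ = c⁻¹ * (f x ^ (1 - l) * g y ^ l) := by rw [hc, mul_inv]; ring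
        _ ≤ _ := by gcongr; exact H x y)
  rw [integral_const_mul, integral_const_mul, integral_const_mul] at key
  have am := Real.geom_mean_le_arith_mean2_weighted (p₁ := a⁻¹ * ∫ x, f x)
    (p₂ := b⁻¹ * ∫ x, g x) hl.le h0.le (by positivity) (by positivity) (by ring)
  have := am.trans key
  rw [Real.mul_rpow (by positivity) nf, Real.mul_rpow (by positivity) ng,
        Real.inv_rpow ha.le, Real.inv_rpow hb.le] at this
  have h3 : c⁻¹ * ((∫ x, f x) ^ (1 - l) * (∫ x, g x) ^ l) ≤ c⁻¹ * ∫ x, h x := by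
    refine le_trans (le_of_eq ?_) this
    rw [hc, mul_inv]; ring
  exact le_of_mul_le_mul_left h3 (by positivity)

/-- Measurable, nonnegative, bounded, and boundedly supported functions. -/
structure NiceFun {n : ℕ} (f : (Fin n → ℝ) → ℝ) : Prop where
  meas : Measurable f
  nonneg : ∀ x, 0 ≤ f x
  bdd : ∃ C, ∀ x, f x ≤ C
  supp : ∃ R, ∀ x, f x ≠ 0 → ∀ i, |x i| ≤ R

lemma NiceFun.integrable {n : ℕ} {f : (Fin n → ℝ) → ℝ} (hf : NiceFun f) : Integrable f := by
  obtain ⟨C, hC⟩ := hf.bdd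
  obtain ⟨R, hR⟩ := hf.supp
  have hs : Function.support f ⊆ Icc (fun _ => -R) (fun _ => R) := by
    intro x hx
    exact ⟨fun i => (abs_le.1 (hR x hx i)).1, fun i => (abs_le.1 (hR x hx i)).2⟩
  rw [← integrableOn_iff_integrable_of_support_subset hs]
  apply Measure.integrableOn_of_bounded (M := C) isCompact_Icc.measure_lt_top.ne
    hf.meas.aestronglyMeasurable
  exact Filter.Eventually.of_forall fun x => by
    rw [Real.norm_of_nonneg (hf.nonneg x)]; exact hC x

lemma NiceFun.slice {n : ℕ} {f : (Fin (n + 1) → ℝ) → ℝ} (hf : NiceFun f) (t : ℝ) :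
    NiceFun fun x : Fin n → ℝ => f (Fin.cons t x) := by
  obtain ⟨C, hC⟩ := hf.bdd
  obtain ⟨R, hR⟩ := hf.supp
  refine ⟨hf.meas.comp ?_, fun x => hf.nonneg _, ⟨C, fun x => hC _⟩, R, fun x hx i => ?_⟩
  · rw [measurable_pi_iff]
    intro i
    refine Fin.cases ?_ (fun i => ?_) i
    · simp
    · simpa using measurable_pi_apply i
  · simpa using hR _ hx i.succ

lemma measurable_cons' {n : ℕ} :
    Measurable fun p : ℝ × (Fin n → ℝ) => (Fin.cons p.1 p.2 : Fin (n + 1) → ℝ) := by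
  rw [measurable_pi_iff]
  intro i
  refine Fin.cases ?_ (fun i => ?_) i
  · simpa using measurable_fst
  · simp only [Fin.cons_succ]
    fun_prop

lemma NiceFun.marginal_meas {n : ℕ} {f : (Fin (n + 1) → ℝ) → ℝ} (hf : NiceFun f) :
    Measurable fun t => ∫ x : Fin n → ℝ, f (Fin.cons t x) := by
  have : StronglyMeasurable fun p : ℝ × (Fin n → ℝ) => f (Fin.cons p.1 p.2) :=
    (hf.meas.comp measurable_cons').stronglyMeasurable
  exact this.integral_prod_right.measurable

lemma NiceFun.prod {n : ℕ} {f : (Fin (n + 1) → ℝ) → ℝ} (hf : NiceFun f) :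
    Integrable (fun p : ℝ × (Fin n → ℝ) => f (Fin.cons p.1 p.2)) ∧
    ∫ p : ℝ × (Fin n → ℝ), f (Fin.cons p.1 p.2) = ∫ x, f x := by
  have mp := (volume_preserving_piFinSuccAbove (fun _ : Fin (n + 1) => ℝ) 0).symm
  have e : (fun p : ℝ × (Fin n → ℝ) => f (Fin.cons p.1 p.2)) =
      f ∘ (MeasurableEquiv.piFinSuccAbove (fun _ : Fin (n + 1) => ℝ) 0).symm := by
    ext p
    simp [MeasurableEquiv.piFinSuccAbove, Fin.insertNthEquiv]
  constructor
  · rw [e]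
    exact (mp.integrable_comp_emb (MeasurableEquiv.measurableEmbedding _)).2 hf.integrable
  · rw [e]
    exact mp.integral_comp (MeasurableEquiv.measurableEmbedding _) f

lemma NiceFun.marginal_bdd {n : ℕ} {f : (Fin (n + 1) → ℝ) → ℝ} (hf : NiceFun f) :
    BddAbove (range fun t => ∫ x : Fin n → ℝ, f (Fin.cons t x)) := by
  obtain ⟨C, hC⟩ := hf.bdd
  obtain ⟨R, hR⟩ := hf.supp
  refine ⟨C * volume.real (Icc (fun _ : Fin n => -R) (fun _ => R)), ?_⟩
  rintro _ ⟨t, rfl⟩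
  have hs : ∀ x ∉ Icc (fun _ : Fin n => -R) (fun _ => R), f (Fin.cons t x) = 0 := by
    intro x hx
    by_contra h
    apply hx
    have := fun i : Fin n => abs_le.1 (hR _ h i.succ)
    simp only [Fin.cons_succ] at this
    exact ⟨fun i => (this i).1, fun i => (this i).2⟩
  simp only
  rw [← setIntegral_eq_integral_of_forall_compl_eq_zero hs]
  refine (Real.le_norm_self _).trans ?_
  apply norm_setIntegral_le_of_norm_le_const isCompact_Icc.measure_lt_top
  intro x _
  rw [Real.norm_of_nonneg (hf.nonneg _)]; exact hC _

theorem prekopa_leindler {l : ℝ} (h0 : 0 < l) (h1 : l < 1) : ∀ (n : ℕ)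
    (f g h : (Fin n → ℝ) → ℝ), NiceFun f → NiceFun g → NiceFun h →
    (∀ x y, f x ^ (1 - l) * g y ^ l ≤ h ((1 - l) • x + l • y)) →
    (∫ x, f x) ^ (1 - l) * (∫ x, g x) ^ l ≤ ∫ x, h x := by
  intro n
  induction n with
  | zero =>
    intro f g h _ _ _ H
    rw [integral_unique, integral_unique, integral_unique]
    have := H (@default _ Unique.instInhabited) (@default _ Unique.instInhabited)
    rw [Subsingleton.elim ((1 - l) • (@default (Fin 0 → ℝ) Unique.instInhabited) +
      l • (@default (Fin 0 → ℝ) Unique.instInhabited))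
      (@default (Fin 0 → ℝ) Unique.instInhabited)] at this
    have hv : volume.real (univ : Set (Fin 0 → ℝ)) = 1 := by
      rw [Measure.real, Measure.volume_pi_eq_dirac default]; simp
    rw [hv]
    simp only [one_smul]
    exact this
  | succ n ih =>
    intro f g h nf ng nh H
    rw [← nf.prod.2, ← ng.prod.2, ← nh.prod.2, Measure.volume_eq_prod,
      integral_prod _ nf.prod.1, integral_prod _ ng.prod.1, integral_prod _ nh.prod.1]
    apply pl1 h0 h1 nf.marginal_meas ng.marginal_meas nh.marginal_meas
      (fun t => integral_nonneg fun x => nf.nonneg _)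
      (fun t => integral_nonneg fun x => ng.nonneg _)
      (fun t => integral_nonneg fun x => nh.nonneg _)
      nf.prod.1.integral_prod_left ng.prod.1.integral_prod_left nh.prod.1.integral_prod_left
      nf.marginal_bdd ng.marginal_bdd
    intro s t
    apply ih _ _ _ (nf.slice s) (ng.slice t) (nh.slice _)
    intro x y
    convert H (Fin.cons s x) (Fin.cons t y) using 2
    ext i
    refine Fin.cases ?_ (fun i => ?_) i <;> simp

lemma NiceFun.indicator {n : ℕ} {A : Set (Fin n → ℝ)} (hA : IsCompact A) :
    NiceFun (A.indicator fun _ => (1 : ℝ)) := by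
  refine ⟨measurable_const.indicator hA.measurableSet, fun x => indicator_nonneg (by simp) x,
    ⟨1, fun x => indicator_le_self' (by simp) x⟩, ?_⟩
  obtain ⟨R, hR⟩ := hA.isBounded.exists_norm_le
  refine ⟨R, fun x hx i => ?_⟩
  have : x ∈ A := by
    by_contra h; simp [h] at hx
  exact (norm_le_pi_norm x i).trans (hR x this)

lemma bm_mul {n : ℕ} {A B C : Set (Fin n → ℝ)} {l : ℝ} (h0 : 0 < l) (h1 : l < 1)
    (hA : IsCompact A) (hB : IsCompact B) (hC : IsCompact C)
    (H : ∀ x ∈ A, ∀ y ∈ B, (1 - l) • x + l • y ∈ C) :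
    volume.real A ^ (1 - l) * volume.real B ^ l ≤ volume.real C := by
  have hl : 0 < 1 - l := by linarith
  have := prekopa_leindler h0 h1 n _ _ _ (NiceFun.indicator hA) (NiceFun.indicator hB)
    (NiceFun.indicator hC) (by
      intro x y
      by_cases hx : x ∈ A
      · by_cases hy : y ∈ B
        · simp [hx, hy, H x hx y hy]
        · simp [hy, Real.zero_rpow h0.ne', indicator_nonneg]
      · simp [hx, Real.zero_rpow hl.ne', indicator_nonneg])
  simpa [integral_indicator, hA.measurableSet, hB.measurableSet, hC.measurableSet] using this

open scoped Pointwise in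
lemma bm_pos {n : ℕ} {A B C : Set (EuclideanSpace ℝ (Fin n))} {α β : ℝ} (hα : 0 < α) (hβ : 0 < β)
    (hA : IsCompact A) (hB : IsCompact B) (hC : IsCompact C)
    (H : ∀ x ∈ A, ∀ y ∈ B, x + y ∈ C)
    (vA : α ^ n ≤ volume.real A) (vB : β ^ n ≤ volume.real B) :
    (α + β) ^ n ≤ volume.real C := by
  -- transfer
  have tr : ∀ (c : ℝ) (S : Set (EuclideanSpace ℝ (Fin n))), 0 < c → IsCompact S →
      IsCompact ((fun x : Fin n → ℝ => c • WithLp.toLp 2 x) ⁻¹' S) ∧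
      volume.real ((fun x : Fin n → ℝ => c • WithLp.toLp 2 x) ⁻¹' S) =
        volume.real S / c ^ n := by
    intro c S hc hS
    have e : ((fun x : Fin n → ℝ => c • WithLp.toLp 2 x) ⁻¹' S) =
        (WithLp.toLp 2) ⁻¹' (c⁻¹ • S) := by
      ext x
      simp [Set.mem_inv_smul_set_iff₀ hc.ne']
    have cS : IsCompact (c⁻¹ • S) := hS.smul _
    rw [e]
    constructor
    · exact (EuclideanSpace.equiv (Fin n) ℝ).symm.toHomeomorph.isCompact_preimage.2 cS
    · rw [Measure.real, (PiLp.volume_preserving_toLp (Fin n)).measure_preimage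
        cS.measurableSet.nullMeasurableSet, Measure.addHaar_smul]
      simp only [finrank_euclideanSpace, Fintype.card_fin, ENNReal.toReal_mul, Measure.real]
      rw [ENNReal.toReal_ofReal (abs_nonneg _), abs_of_pos (by positivity), inv_pow]
      field_simp
  have hs : 0 < α + β := by positivity
  obtain ⟨cA, eA⟩ := tr α A hα hA
  obtain ⟨cB, eB⟩ := tr β B hβ hB
  obtain ⟨cC, eC⟩ := tr (α + β) C hs hC
  have h1 : 1 - β / (α + β) = α / (α + β) := by field_simp; ring
  have := bm_mul (l := β / (α + β)) (by positivity) (by rw [div_lt_one hs]; linarith) cA cB cC (by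
    intro x hx y hy
    have := H _ hx _ hy
    simp only [mem_preimage] at hx hy ⊢
    convert this using 1
    rw [h1]
    ext i
    simp
    field_simp)
  have g1 : 1 ≤ volume.real A / α ^ n := by rwa [le_div_iff₀ (by positivity), one_mul]
  have g2 : 1 ≤ volume.real B / β ^ n := by rwa [le_div_iff₀ (by positivity), one_mul]
  rw [eA, eB, eC, h1] at this
  have g3 : 1 ≤ volume.real C / (α + β) ^ n := by
    refine le_trans ?_ this
    have := one_le_mul_of_one_le_of_one_le
      (Real.one_le_rpow g1 (z := α / (α + β)) (by positivity))
      (Real.one_le_rpow g2 (z := β / (α + β)) (by positivity))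
    exact this
  rwa [le_div_iff₀ (by positivity), one_mul] at g3

lemma bm {n : ℕ} {A B C : Set (EuclideanSpace ℝ (Fin n))} {α β : ℝ} (hα : 0 < α) (hβ : 0 ≤ β)
    (hA : IsCompact A) (hB : IsCompact B) (hBn : B.Nonempty) (hC : IsCompact C)
    (H : ∀ x ∈ A, ∀ y ∈ B, x + y ∈ C)
    (vA : α ^ n ≤ volume.real A) (vB : β ^ n ≤ volume.real B) :
    (α + β) ^ n ≤ volume.real C := by
  rcases hβ.eq_or_lt with rfl | hβ
  · obtain ⟨b, hb⟩ := hBn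
    rw [add_zero]
    refine vA.trans ?_
    have : volume.real A = volume.real ((fun x => x + b) '' A) := by
      rw [Set.image_add_right, Measure.real, Measure.real, measure_preimage_add_right]
    rw [this]
    apply measureReal_mono _ hC.measure_lt_top.ne
    rintro _ ⟨a, ha, rfl⟩
    exact H a ha b hb
  · exact bm_pos hα hβ hA hB hC H vA vB

lemma compare_profiles {n : ℕ} {G : ℝ → ℝ} {V m M : ℝ} (hm : 0 < m) (hmM : m ≤ M)
    (hG : Antitone G)
    (cross : ∀ t s, 0 < t → t < s → V * (max (1 - s / m) 0) ^ n < G s →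
      V * (max (1 - t / m) 0) ^ n ≤ G t)
    (hI : ∫ t in (0:ℝ)..M, G t = V * m / (n + 1)) (hn : 0 < n) :
    ∫ t in (0:ℝ)..M, t * G t ≤ V * m ^ 2 / ((n + 1) * (n + 2)) := by
  set G0 : ℝ → ℝ := fun t => V * (max (1 - t / m) 0) ^ n with hG0
  have cG0 : Continuous G0 := by fun_prop
  have iG : ∀ a b, IntervalIntegrable G volume a b := fun a b => hG.intervalIntegrable
  have iG0 : ∀ a b, IntervalIntegrable G0 volume a b := fun a b => cG0.intervalIntegrable _ _
  have z0 : ∀ k : ℝ → ℝ, ∫ t in m..M, k t * G0 t = 0 := by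
    intro k
    rw [intervalIntegral.integral_congr (g := fun _ => 0)]
    · simp
    · intro t ht
      rw [uIcc_of_le hmM] at ht
      have : 1 - t / m ≤ 0 := by rw [sub_nonpos, one_le_div hm]; exact ht.1
      simp [hG0, max_eq_right this, hn.ne']
  have hn1 : (n : ℝ) + 1 ≠ 0 := by positivity
  have hn2 : (n : ℝ) + 2 ≠ 0 := by positivity
  have J0 : ∫ t in (0:ℝ)..M, G0 t = V * m / (n + 1) := by
    have z := z0 (fun _ => 1)
    simp only [one_mul] at z
    rw [← intervalIntegral.integral_add_adjacent_intervals (iG0 0 m) (iG0 m M), z, add_zero]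
    have e : ∫ t in (0:ℝ)..m, G0 t = ∫ t in (0:ℝ)..m, V * (1 - t / m) ^ n := by
      apply intervalIntegral.integral_congr
      intro t ht
      rw [uIcc_of_le hm.le] at ht
      have : 0 ≤ 1 - t / m := by rw [sub_nonneg, div_le_one hm]; exact ht.2
      simp [hG0, max_eq_left this]
    rw [e, intervalIntegral.integral_eq_sub_of_hasDerivAt
      (f := fun t => -(V * m / (n + 1)) * (1 - t / m) ^ (n + 1))]
    · simp [hm.ne']
    · intro t _
      have h1 : HasDerivAt (fun t : ℝ => 1 - t / m) (-(1 / m)) t :=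
        ((hasDerivAt_id t).div_const m).const_sub 1
      refine ((h1.fun_pow (n + 1)).const_mul (-(V * m / (n + 1)))).congr_deriv ?_
      push_cast
      field_simp
    · exact Continuous.intervalIntegrable (by fun_prop) _ _
  have J1 : ∫ t in (0:ℝ)..M, t * G0 t = V * m ^ 2 / ((n + 1) * (n + 2)) := by
    have z := z0 (fun t => t)
    have ii : ∀ a b, IntervalIntegrable (fun t => t * G0 t) volume a b :=
      fun a b => Continuous.intervalIntegrable (by fun_prop) _ _
    rw [← intervalIntegral.integral_add_adjacent_intervals (ii 0 m) (ii m M), z, add_zero]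
    have e : ∫ t in (0:ℝ)..m, t * G0 t = ∫ t in (0:ℝ)..m, t * (V * (1 - t / m) ^ n) := by
      apply intervalIntegral.integral_congr
      intro t ht
      rw [uIcc_of_le hm.le] at ht
      have : 0 ≤ 1 - t / m := by rw [sub_nonneg, div_le_one hm]; exact ht.2
      simp [hG0, max_eq_left this]
    rw [e, intervalIntegral.integral_eq_sub_of_hasDerivAt
      (f := fun t => -(V * m ^ 2 / (n + 1)) * (1 - t / m) ^ (n + 1) +
        (V * m ^ 2 / (n + 2)) * (1 - t / m) ^ (n + 2))]
    · simp [hm.ne']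
      field_simp
      ring
    · intro t _
      have h1 : HasDerivAt (fun t : ℝ => 1 - t / m) (-(1 / m)) t :=
        ((hasDerivAt_id t).div_const m).const_sub 1
      refine (((h1.fun_pow (n + 1)).const_mul (-(V * m ^ 2 / (n + 1)))).fun_add
        ((h1.fun_pow (n + 2)).const_mul (V * m ^ 2 / (n + 2)))).congr_deriv ?_
      push_cast
      obtain ⟨u, hu⟩ : ∃ u, u = 1 - t / m := ⟨_, rfl⟩
      have ht : t = m * (1 - u) := by rw [hu]; field_simp; ring
      rw [← hu, ht]
      field_simp
      ring
    · exact Continuous.intervalIntegrable (by fun_prop) _ _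
  have hM : 0 ≤ M := hm.le.trans hmM
  -- crossing point
  obtain ⟨t0, h1, h2⟩ : ∃ t0, (∀ t, 0 < t → t < t0 → G0 t ≤ G t) ∧
      (∀ t, 0 < t → t ≤ M → t0 < t → G t ≤ G0 t) := by
    by_cases hS : ({s | 0 < s ∧ s ≤ M ∧ G0 s < G s} : Set ℝ).Nonempty
    · have hb : BddAbove {s | 0 < s ∧ s ≤ M ∧ G0 s < G s} := ⟨M, fun s hs => hs.2.1⟩
      refine ⟨sSup {s | 0 < s ∧ s ≤ M ∧ G0 s < G s}, ?_, ?_⟩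
      · intro t ht hlt
        obtain ⟨s, hs, hts⟩ := exists_lt_of_lt_csSup hS hlt
        exact cross t s ht hts hs.2.2
      · intro t ht htM hlt
        by_contra hcon
        exact absurd (le_csSup hb ⟨ht, htM, not_le.1 hcon⟩) (not_le.2 hlt)
    · refine ⟨0, fun t h1 h2 => absurd h1 (not_lt.2 h2.le), fun t ht htM _ => ?_⟩
      by_contra hcon
      exact hS ⟨t, ht, htM, not_le.1 hcon⟩
  have itG : IntervalIntegrable (fun t => t * G t) volume 0 M :=
    (iG 0 M).continuousOn_mul continuousOn_id
  have key : ∫ t in (0:ℝ)..M, t * G t - t0 * G t ≤ ∫ t in (0:ℝ)..M, t * G0 t - t0 * G0 t := by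
    apply intervalIntegral.integral_mono_on_of_le_Ioo hM
    · exact itG.sub ((iG 0 M).const_mul _)
    · exact Continuous.intervalIntegrable (by fun_prop) _ _
    · intro t ht
      rcases lt_trichotomy t t0 with h | h | h
      · nlinarith [h1 t ht.1 h]
      · simp [h]
      · nlinarith [h2 t ht.1 ht.2.le h]
  rw [intervalIntegral.integral_sub itG ((iG 0 M).const_mul _),
    intervalIntegral.integral_sub (Continuous.intervalIntegrable (by fun_prop) _ _)
      ((iG0 0 M).const_mul _), intervalIntegral.integral_const_mul,
    intervalIntegral.integral_const_mul, hI, J0, J1] at key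
  linarith

lemma volume_real_smul {n : ℕ} (S : Set (EuclideanSpace ℝ (Fin n))) {c : ℝ} (hc : 0 ≤ c) :
    volume.real ((fun x => c • x) '' S) = c ^ n * volume.real S := by
  rw [Set.image_smul, Measure.real, Measure.addHaar_smul]
  simp only [finrank_euclideanSpace, Fintype.card_fin, ENNReal.toReal_mul, Measure.real]
  rw [ENNReal.toReal_ofReal (abs_nonneg _), abs_of_nonneg (by positivity)]

lemma tail_concave {n : ℕ} (hn : 0 < n) {K : Set (EuclideanSpace ℝ (Fin n))} (hK : IsCompact K)
    (hconv : Convex ℝ K) (hV : 0 < volume.real K)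
    {Z : EuclideanSpace ℝ (Fin n) → ℝ} (cZ : Continuous Z)
    (aZ : ∀ x y : EuclideanSpace ℝ (Fin n), ∀ a b : ℝ, a + b = 1 →
      Z (a • x + b • y) = a * Z x + b * Z y)
    (pZ : ∀ y ∈ K, 0 ≤ Z y) {t s c : ℝ} (ht : 0 < t) (hts : t < s) (hc : 0 ≤ c)
    (h : volume.real K * c ^ n < volume.real (K ∩ {y | s ≤ Z y})) :
    volume.real K * ((1 - t / s) + t / s * c) ^ n ≤ volume.real (K ∩ {y | t ≤ Z y}) := by
  have hs : 0 < s := ht.trans hts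
  have hcl : ∀ r : ℝ, IsCompact (K ∩ {y | r ≤ Z y}) := fun r =>
    hK.inter_right (isClosed_le continuous_const cZ)
  set v := volume.real K ^ ((n : ℝ)⁻¹) with hv
  have hvp : 0 < v := by positivity
  have hvn : v ^ n = volume.real K := Real.rpow_inv_natCast_pow hV.le hn.ne'
  have l1 : 0 < 1 - t / s := by rw [sub_pos, div_lt_one hs]; exact hts
  have l2 : 0 < t / s := by positivity
  have ne : (K ∩ {y | s ≤ Z y}).Nonempty := by
    by_contra hcon
    rw [not_nonempty_iff_eq_empty] at hcon
    rw [hcon, measureReal_empty] at h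
    exact absurd h (not_lt.2 (by positivity))
  have := bm (α := (1 - t / s) * v) (β := t / s * (v * c)) (A := (fun x => (1 - t / s) • x) '' K)
    (B := (fun x => (t / s) • x) '' (K ∩ {y | s ≤ Z y})) (C := K ∩ {y | t ≤ Z y})
    (by positivity) (by positivity) (hK.image (by fun_prop)) ((hcl s).image (by fun_prop))
    (ne.image _) (hcl t) (by
      rintro _ ⟨x, hx, rfl⟩ _ ⟨y, ⟨hy, hy2⟩, rfl⟩
      refine ⟨hconv hx hy l1.le l2.le (by ring), ?_⟩
      change t ≤ Z _
      change s ≤ Z y at hy2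
      simp only
      rw [aZ _ _ _ _ (by ring)]
      have a1 := mul_nonneg l1.le (pZ x hx)
      have a2 := mul_le_mul_of_nonneg_left hy2 l2.le
      rw [div_mul_cancel₀ _ hs.ne'] at a2
      linarith) (by
      rw [volume_real_smul _ l1.le, mul_pow, hvn]) (by
      rw [volume_real_smul _ l2.le, mul_pow, mul_pow, hvn]
      gcongr)
  refine le_trans (le_of_eq ?_) this
  rw [← hvn, ← mul_pow]
  ring

lemma berwald {n : ℕ} (hn : 0 < n) {K : Set (EuclideanSpace ℝ (Fin n))} (hK : IsCompact K)
    (hconv : Convex ℝ K) (hV : 0 < volume.real K)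
    {Z : EuclideanSpace ℝ (Fin n) → ℝ} (cZ : Continuous Z)
    (aZ : ∀ x y : EuclideanSpace ℝ (Fin n), ∀ a b : ℝ, a + b = 1 →
      Z (a • x + b • y) = a * Z x + b * Z y)
    (pZ : ∀ y ∈ K, 0 ≤ Z y) (hI : 0 < ∫ y in K, Z y) :
    (n + 2) * volume.real K * (∫ y in K, Z y ^ 2) ≤ (2 * n + 2) * (∫ y in K, Z y) ^ 2 := by
  set V := volume.real K with hVdef
  set I := ∫ y in K, Z y with hIdef
  set m := (n + 1) * I / V with hm
  have hmp : 0 < m := by positivity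
  obtain ⟨T, hT⟩ := (hK.image cZ).bddAbove
  have hT' : ∀ y ∈ K, Z y ≤ T := fun y hy => hT ⟨y, hy, rfl⟩
  set M := max T m with hM
  have hMp : 0 ≤ M := hmp.le.trans (le_max_right _ _)
  set G : ℝ → ℝ := fun t => volume.real (K ∩ {y | t ≤ Z y}) with hG
  have pn : 0 ≤ᵐ[volume.restrict K] Z := by
    rw [Filter.EventuallyLE, ae_restrict_iff' hK.measurableSet]
    exact Filter.Eventually.of_forall pZ
  have iZ : Integrable Z (volume.restrict K) := cZ.continuousOn.integrableOn_compact hK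
  have iZ2 : Integrable (fun y => Z y ^ 2) (volume.restrict K) :=
    (cZ.pow 2).continuousOn.integrableOn_compact hK
  have lvl : ∀ t, (volume.restrict K) {y | t ≤ Z y} = volume (K ∩ {y | t ≤ Z y}) := by
    intro t
    rw [Measure.restrict_apply (isClosed_le continuous_const cZ).measurableSet, inter_comm]
  have fin : ∀ t, volume (K ∩ {y | t ≤ Z y}) ≠ ⊤ := fun t =>
    ((measure_mono inter_subset_left).trans_lt hK.measure_lt_top).ne
  have antiG : Antitone G := by
    intro a b hab
    exact measureReal_mono (inter_subset_inter_right _ fun y hy => le_trans hab hy) (fin a)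
  have zG : ∀ t, M < t → G t = 0 := by
    intro t ht
    have : K ∩ {y | t ≤ Z y} = ∅ := by
      ext y
      simp only [mem_inter_iff, mem_empty_iff_false, iff_false, not_and]
      intro hy hy2
      have h1 := hT' y hy
      have h2 : t ≤ Z y := hy2
      have := le_max_left T m
      linarith
    simp [hG, this]
  have L1 : ∫ t in (0:ℝ)..M, G t = V * m / (n + 1) := by
    have e : V * m / (n + 1) = I := by rw [hm]; field_simp
    rw [e, hIdef, Integrable.integral_eq_integral_Ioc_meas_le (M := M) iZ pn,
      intervalIntegral.integral_of_le hMp]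
    · apply integral_congr_ae
      exact Filter.Eventually.of_forall fun t => by simp only [hG, Measure.real, lvl]
    · rw [Filter.EventuallyLE, ae_restrict_iff' hK.measurableSet]
      exact Filter.Eventually.of_forall fun y hy => (hT' y hy).trans (le_max_left _ _)
  have L2 : ∫ y in K, Z y ^ 2 = 2 * ∫ t in (0:ℝ)..M, t * G t := by
    have lc := lintegral_comp_eq_lintegral_meas_le_mul (volume.restrict K) pn
      cZ.measurable.aemeasurable (g := fun t => 2 * t)
      (fun t _ => Continuous.intervalIntegrable (by fun_prop) _ _)
      (by
        rw [ae_restrict_iff' measurableSet_Ioi]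
        exact Filter.Eventually.of_forall fun t ht => by
          have : (0:ℝ) < t := ht
          positivity)
    have e1 : ∀ a : ℝ, ∫ t in (0:ℝ)..a, 2 * t = a ^ 2 := by
      intro a
      rw [intervalIntegral.integral_const_mul, integral_id]; ring
    simp only [e1, lvl] at lc
    rw [integral_eq_lintegral_of_nonneg_ae (Filter.Eventually.of_forall fun y => sq_nonneg _)
      iZ2.aestronglyMeasurable, lc, ← intervalIntegral.integral_const_mul,
      intervalIntegral.integral_of_le hMp]
    have e2 : ∫ t in Ioc 0 M, 2 * (t * G t) = ∫ t in Ioi 0, 2 * (t * G t) := by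
      symm
      apply setIntegral_eq_of_subset_of_forall_sdiff_eq_zero measurableSet_Ioi Ioc_subset_Ioi_self
      intro t ht
      have h0 : 0 < t := ht.1
      have : M < t := by
        by_contra hcon
        exact ht.2 ⟨h0, not_lt.1 hcon⟩
      rw [zG t this]; ring
    rw [e2, integral_eq_lintegral_of_nonneg_ae]
    · congr 1
      apply setLIntegral_congr_fun measurableSet_Ioi
      intro t ht
      have ht : (0:ℝ) < t := ht
      simp only [hG]
      rw [show 2 * (t * volume.real (K ∩ {y | t ≤ Z y})) =
        volume.real (K ∩ {y | t ≤ Z y}) * (2 * t) by ring, ENNReal.ofReal_mul measureReal_nonneg,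
        ofReal_measureReal (fin t)]
    · rw [Filter.EventuallyLE, ae_restrict_iff' measurableSet_Ioi]
      exact Filter.Eventually.of_forall fun t ht => by
        have : (0:ℝ) < t := ht
        have : 0 ≤ G t := measureReal_nonneg
        simp only [Pi.zero_apply]
        positivity
    · exact (measurable_id.mul antiG.measurable).const_mul 2 |>.aestronglyMeasurable
  have cmp := compare_profiles (n := n) (G := G) (V := V) hmp (le_max_right T m) antiG (by
    intro t s ht hts h
    refine le_trans ?_ (tail_concave hn hK hconv hV cZ aZ pZ ht hts (le_max_right _ _) h)
    have hs : 0 < s := ht.trans hts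
    have hts1 : t / s < 1 := by rw [div_lt_one hs]; exact hts
    have hts0 : 0 < t / s := by positivity
    gcongr
    apply max_le
    · have : 1 - s / m ≤ max (1 - s / m) 0 := le_max_left _ _
      have h2 := mul_le_mul_of_nonneg_left this hts0.le
      have h3 : t / s * (1 - s / m) = t / s - t / m := by field_simp
      linarith
    · have : 0 ≤ max (1 - s / m) 0 := le_max_right _ _
      have := mul_nonneg hts0.le this
      linarith) L1 hn
  rw [L2]
  have h3 : V * m ^ 2 / ((n + 1) * (n + 2)) = (n + 1) * I ^ 2 / (V * (n + 2)) := by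
    rw [hm]; field_simp
  rw [h3, le_div_iff₀ (by positivity)] at cmp
  nlinarith

lemma setIntegral_cs {n : ℕ} {D : Set (EuclideanSpace ℝ (Fin n))} {f : EuclideanSpace ℝ (Fin n) → ℝ}
    (hD : volume D ≠ ⊤)
    (i1 : IntegrableOn f D) (i2 : IntegrableOn (fun y => f y ^ 2) D) :
    (∫ y in D, f y) ^ 2 ≤ volume.real D * ∫ y in D, f y ^ 2 := by
  have key : ∀ c : ℝ, 0 ≤ volume.real D * (c * c) + (-2 * ∫ y in D, f y) * c +
      ∫ y in D, f y ^ 2 := by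
    intro c
    have h : 0 ≤ ∫ y in D, (f y - c) ^ 2 := integral_nonneg fun y => sq_nonneg _
    have ic : IntegrableOn (fun _ => c ^ 2) D := integrableOn_const hD
    have e : ∫ y in D, (f y - c) ^ 2 =
        (∫ y in D, f y ^ 2) - (2 * c) * (∫ y in D, f y) + volume.real D * c ^ 2 := by
      have e1 : ∀ y, (f y - c) ^ 2 = f y ^ 2 - (2 * c) * f y + c ^ 2 := fun y => by ring
      simp only [e1]
      have i3 : IntegrableOn (fun y => f y ^ 2 - (2 * c) * f y) D := i2.sub (i1.const_mul _)
      rw [integral_add i3 ic, integral_sub i2 (i1.const_mul _),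
        integral_const_mul, setIntegral_const, smul_eq_mul]
    rw [e] at h
    linarith
  have := discrim_le_zero key
  rw [discrim] at this
  linarith

open scoped Pointwise in
lemma star_ineq {n : ℕ} {K : Set (EuclideanSpace ℝ (Fin n))} (hK : IsCompact K)
    (hconv : Convex ℝ K) (h0 : (0 : EuclideanSpace ℝ (Fin n)) ∈ K)
    (L : EuclideanSpace ℝ (Fin n) →L[ℝ] ℝ) :
    ((n + 1 : ℝ) * ∫ y in K, L y) ^ 2 ≤ n * volume.real K * ((n + 2) * ∫ y in K, L y ^ 2) := by
  have i1 : IntegrableOn L K := L.continuous.continuousOn.integrableOn_compact hK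
  have i2 : IntegrableOn (fun y => L y ^ 2) K :=
    (L.continuous.pow 2).continuousOn.integrableOn_compact hK
  set P : ℕ → ℝ → ℝ := fun k s => ∑ i ∈ Finset.range k, s ^ i with hP
  have cP : ∀ k, Continuous (P k) := fun k => by fun_prop
  have P1 : ∀ k, P k 1 = k := fun k => by simp [hP]
  have hPs : ∀ k s, 1 - s ^ k = (1 - s) * P k s := by
    intro k s
    have := geom_sum_mul s k
    simp only [hP]
    linarith
  have main : ∀ s, 0 < s → s < 1 →
      (P (n + 1) s * ∫ y in K, L y) ^ 2 ≤
        P n s * volume.real K * (P (n + 2) s * ∫ y in K, L y ^ 2) := by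
    intro s hs hs1
    have sub : s • K ⊆ K := by
      rintro _ ⟨y, hy, rfl⟩
      exact (hconv.starConvex h0).smul_mem hy hs.le hs1.le
    have cK : IsCompact (s • K) := hK.smul s
    have v : volume.real (s • K) = s ^ n * volume.real K := by
      rw [← Set.image_smul]; exact volume_real_smul K hs.le
    have fd : Module.finrank ℝ (EuclideanSpace ℝ (Fin n)) = n := by simp
    have e1 : ∫ y in s • K, L y = s ^ (n + 1) * ∫ y in K, L y := by
      have := Measure.setIntegral_comp_smul_of_pos volume (fun y => L y) K hs
      rw [fd] at this
      simp only [map_smul, smul_eq_mul, integral_const_mul] at this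
      rw [eq_inv_mul_iff_mul_eq₀ (by positivity)] at this
      rw [← this]; ring
    have e2 : ∫ y in s • K, L y ^ 2 = s ^ (n + 2) * ∫ y in K, L y ^ 2 := by
      have := Measure.setIntegral_comp_smul_of_pos volume (fun y => L y ^ 2) K hs
      rw [fd] at this
      simp only [map_smul, smul_eq_mul, mul_pow, integral_const_mul] at this
      rw [eq_inv_mul_iff_mul_eq₀ (by positivity)] at this
      rw [← this]; ring
    have cs := setIntegral_cs (D := K \ (s • K)) (f := L)
      ((measure_mono sdiff_subset).trans_lt hK.measure_lt_top).ne
      (i1.mono_set sdiff_subset) (i2.mono_set sdiff_subset)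
    rw [setIntegral_sdiff cK.measurableSet i1 sub, setIntegral_sdiff cK.measurableSet i2 sub,
      measureReal_sdiff sub cK.measurableSet hK.measure_lt_top.ne, e1, e2, v] at cs
    have h1 := hPs (n + 1) s
    have h2 := hPs (n + 2) s
    have h3 := hPs n s
    have hp : 0 < (1 - s) ^ 2 := by have : 0 < 1 - s := by linarith
                                    positivity
    refine le_of_mul_le_mul_left ?_ hp
    calc _ = ((1 - s ^ (n + 1)) * ∫ y in K, L y) ^ 2 := by rw [h1]; ring
      _ ≤ ((1 - s ^ n) * volume.real K) * ((1 - s ^ (n + 2)) * ∫ y in K, L y ^ 2) := by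
        refine le_trans (le_of_eq ?_) (cs.trans (le_of_eq ?_)) <;> ring
      _ = _ := by rw [h2, h3]; ring
  have lim1 : Filter.Tendsto (fun s => (P (n + 1) s * ∫ y in K, L y) ^ 2) (nhdsWithin 1 (Iio 1))
      (nhds ((P (n + 1) 1 * ∫ y in K, L y) ^ 2)) :=
    (Continuous.tendsto (f := fun s => (P (n + 1) s * ∫ y in K, L y) ^ 2)
      (((cP _).mul continuous_const).pow 2) 1).mono_left nhdsWithin_le_nhds
  have lim2 : Filter.Tendsto
      (fun s => P n s * volume.real K * (P (n + 2) s * ∫ y in K, L y ^ 2)) (nhdsWithin 1 (Iio 1))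
      (nhds (P n 1 * volume.real K * (P (n + 2) 1 * ∫ y in K, L y ^ 2))) :=
    (Continuous.tendsto (f := fun s => P n s * volume.real K * (P (n + 2) s * ∫ y in K, L y ^ 2))
      (((cP _).mul continuous_const).mul ((cP _).mul continuous_const)) 1).mono_left
        nhdsWithin_le_nhds
  have fin := le_of_tendsto_of_tendsto lim1 lim2 (by
    have : Ioo (0:ℝ) 1 ∈ nhdsWithin 1 (Iio 1) := Ioo_mem_nhdsLT (by norm_num)
    filter_upwards [this] with s hs
    exact main s hs.1 hs.2)
  rw [P1, P1, P1] at fin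
  push_cast at fin
  exact fin

/-- the version with a general base point `x ∈ K`. -/
lemma star_ineq' {n : ℕ} {K : Set (EuclideanSpace ℝ (Fin n))} (hK : IsCompact K)
    (hconv : Convex ℝ K) {x : EuclideanSpace ℝ (Fin n)} (hx : x ∈ K)
    (L : EuclideanSpace ℝ (Fin n) →L[ℝ] ℝ) :
    ((n + 1 : ℝ) * ∫ y in K, L (y - x)) ^ 2 ≤
      n * volume.real K * ((n + 2) * ∫ y in K, L (y - x) ^ 2) := by
  have mp : MeasurePreserving (fun y : EuclideanSpace ℝ (Fin n) => y + x) volume volume :=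
    measurePreserving_add_right volume x
  have me : MeasurableEmbedding (fun y : EuclideanSpace ℝ (Fin n) => y + x) :=
    (Homeomorph.addRight x).measurableEmbedding
  have cK : IsCompact ((fun y => y + x) ⁻¹' K) := (Homeomorph.addRight x).isCompact_preimage.2 hK
  have cv : Convex ℝ ((fun y => y + x) ⁻¹' K) := hconv.translate_preimage_left x
  have := star_ineq cK cv (by simpa using hx) L
  have e1 := mp.setIntegral_preimage_emb me (fun y => L (y - x)) K
  have e2 := mp.setIntegral_preimage_emb me (fun y => L (y - x) ^ 2) K
  simp only [add_sub_cancel_right] at e1 e2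
  have e3 : volume.real ((fun y => y + x) ⁻¹' K) = volume.real K := by
    rw [Measure.real, measure_preimage_add_right, Measure.real]
  rw [e1, e2, e3] at this
  exact this

lemma quad_cs {d : ℕ} {S : Matrix (Fin d) (Fin d) ℝ} (hS : S.PosDef) (w z : Fin d → ℝ) :
    (w ⬝ᵥ z) ^ 2 ≤ (w ⬝ᵥ S.mulVec w) * (z ⬝ᵥ S⁻¹.mulVec z) := by
  have hu : S * S⁻¹ = 1 := Matrix.mul_nonsing_inv S (Matrix.isUnit_iff_isUnit_det S |>.1 hS.isUnit)
  have hT : S.transpose = S := by simpa using hS.isHermitian.eq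
  set p := S⁻¹.mulVec z with hp
  have e1 : S.mulVec p = z := by rw [hp, Matrix.mulVec_mulVec, hu, Matrix.one_mulVec]
  have e2 : p ⬝ᵥ S.mulVec w = w ⬝ᵥ z := by
    rw [Matrix.dotProduct_mulVec, ← Matrix.mulVec_transpose, hT, e1, dotProduct_comm]
  have key : ∀ t : ℝ, 0 ≤ (z ⬝ᵥ p) * (t * t) + (-2 * (w ⬝ᵥ z)) * t + w ⬝ᵥ S.mulVec w := by
    intro t
    have := hS.posSemidef.dotProduct_mulVec_nonneg (w - t • p)
    simp only [star_trivial, Matrix.mulVec_sub, Matrix.mulVec_smul, sub_dotProduct,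
      dotProduct_sub, smul_dotProduct, dotProduct_smul, smul_eq_mul, e1, e2] at this
    rw [dotProduct_comm p z] at this
    linarith
  have := discrim_le_zero key
  rw [discrim] at this
  linarith

lemma quad_inv {d : ℕ} {S : Matrix (Fin d) (Fin d) ℝ} (hS : S.PosDef) (z : Fin d → ℝ) :
    (S⁻¹.mulVec z) ⬝ᵥ S.mulVec (S⁻¹.mulVec z) = z ⬝ᵥ S⁻¹.mulVec z := by
  have hu : S * S⁻¹ = 1 := Matrix.mul_nonsing_inv S (Matrix.isUnit_iff_isUnit_det S |>.1 hS.isUnit)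
  rw [Matrix.mulVec_mulVec, hu, Matrix.one_mulVec, dotProduct_comm]

lemma quad_sum {d : ℕ} (S : Matrix (Fin d) (Fin d) ℝ) (z : Fin d → ℝ) :
    ∑ i, ∑ j, z i * S i j * z j = z ⬝ᵥ S.mulVec z := by
  simp only [dotProduct, Matrix.mulVec, Finset.mul_sum, mul_assoc]

lemma moments {d : ℕ} {K : Set (EuclideanSpace ℝ (Fin d))}
    (hKc : IsCompact K)
    (μ : EuclideanSpace ℝ (Fin d)) (Sig : Matrix (Fin d) (Fin d) ℝ)
    (hμ : (∫ y in K, y) = (volume K).toReal • μ)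
    (hcov : ∀ i j, (∫ y in K, (y i - μ i) * (y j - μ j)) = (volume K).toReal * Sig i j)
    (L : EuclideanSpace ℝ (Fin d) →L[ℝ] ℝ) (w : Fin d → ℝ)
    (hL : ∀ y, L y = ∑ i, w i * y i) (c : ℝ) :
    (∫ y in K, (L (y - μ) - c)) = - (c * volume.real K) ∧
    (∫ y in K, (L (y - μ) - c) ^ 2) = volume.real K * (w ⬝ᵥ Sig.mulVec w) +
      c ^ 2 * volume.real K := by
  have ic : ∀ f : EuclideanSpace ℝ (Fin d) → ℝ, Continuous f → IntegrableOn f K :=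
    fun f hf => hf.continuousOn.integrableOn_compact hKc
  have iid : IntegrableOn (fun y : EuclideanSpace ℝ (Fin d) => y) K :=
    continuous_id.continuousOn.integrableOn_compact hKc
  have m1 : (∫ y in K, L (y - μ)) = 0 := by
    have e : ∫ y in K, L y = volume.real K * L μ := by
      rw [L.integral_comp_comm iid, hμ, map_smul, smul_eq_mul, Measure.real]
    simp only [map_sub]
    rw [integral_sub (ic _ L.continuous) (ic _ continuous_const), e, setIntegral_const,
      smul_eq_mul, sub_self]
  have m2 : (∫ y in K, L (y - μ) ^ 2) = volume.real K * (w ⬝ᵥ Sig.mulVec w) := by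
    have e : ∀ y, L (y - μ) ^ 2 =
        ∑ i, ∑ j, (w i * w j) * ((y i - μ i) * (y j - μ j)) := by
      intro y
      rw [hL, sq, Finset.sum_mul_sum]
      refine Finset.sum_congr rfl fun i _ => Finset.sum_congr rfl fun j _ => ?_
      simp only [PiLp.sub_apply]
      ring
    simp only [e]
    rw [integral_finsetSum _ (fun i _ => ic _ (by fun_prop))]
    rw [← quad_sum, Finset.mul_sum]
    refine Finset.sum_congr rfl fun i _ => ?_
    rw [Finset.mul_sum, integral_finsetSum _ (fun j _ => ic _ (by fun_prop))]
    refine Finset.sum_congr rfl fun j _ => ?_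
    rw [integral_const_mul, hcov, Measure.real]; ring
  constructor
  · rw [integral_sub (ic _ (by fun_prop)) (ic _ continuous_const), m1, setIntegral_const,
      smul_eq_mul]
    ring
  · have e : ∀ y, (L (y - μ) - c) ^ 2 = L (y - μ) ^ 2 - (2 * c) * L (y - μ) + c ^ 2 :=
      fun y => by ring
    simp only [e]
    rw [integral_add (ic _ (by fun_prop)) (ic _ continuous_const),
      integral_sub (ic _ (by fun_prop)) (ic _ (by fun_prop)), integral_const_mul, m1, m2,
      setIntegral_const, smul_eq_mul]
    ring



/-- Sandwiching a convex body between ellipsoids defined by its centroid `μ` and covariance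
matrix `Sig`: `{x : ‖x−μ‖_{Σ⁻¹} ≤ √((d+2)/d)} ⊆ K ⊆ {x : ‖x−μ‖_{Σ⁻¹} ≤ √(d(d+2))}`. -/
theorem inertial_ellipsoid_sandwich {d : ℕ} (hd : 0 < d)
    (K : Set (EuclideanSpace ℝ (Fin d)))
    (hKc : IsCompact K) (hKconv : Convex ℝ K) (hKint : (interior K).Nonempty)
    (μ : EuclideanSpace ℝ (Fin d)) (Sig : Matrix (Fin d) (Fin d) ℝ) (hSig : Sig.PosDef)
    (hμ : (∫ y in K, y) = (volume K).toReal • μ)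
    (hcov : ∀ i j, (∫ y in K, (y i - μ i) * (y j - μ j)) = (volume K).toReal * Sig i j) :
    {x : EuclideanSpace ℝ (Fin d) |
        Real.sqrt (∑ i, ∑ j, (x i - μ i) * Sig⁻¹ i j * (x j - μ j)) ≤
          Real.sqrt (((d : ℝ) + 2) / d)} ⊆ K ∧
    K ⊆ {x : EuclideanSpace ℝ (Fin d) |
        Real.sqrt (∑ i, ∑ j, (x i - μ i) * Sig⁻¹ i j * (x j - μ j)) ≤
          Real.sqrt ((d : ℝ) * ((d : ℝ) + 2))} := by

  have hVtop : volume K ≠ ⊤ := hKc.measure_lt_top.ne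
  have hV : 0 < volume.real K :=
    ENNReal.toReal_pos ((hKint.mono (by rfl) |> fun h =>
      (isOpen_interior.measure_pos volume h).trans_le (measure_mono interior_subset))).ne' hVtop
  have hd' : (0 : ℝ) < d := by exact_mod_cast hd
  have qs : ∀ x : EuclideanSpace ℝ (Fin d),
      ∑ i, ∑ j, (x i - μ i) * Sig⁻¹ i j * (x j - μ j) =
        (fun i => x i - μ i) ⬝ᵥ Sig⁻¹.mulVec (fun i => x i - μ i) := fun x =>
    quad_sum Sig⁻¹ (fun i => x i - μ i)
  constructor
  · intro x hx
    change Real.sqrt _ ≤ Real.sqrt _ at hx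
    rw [qs, Real.sqrt_le_sqrt_iff (by positivity)] at hx
    by_contra hxK
    obtain ⟨f, u, hfu, hux⟩ := geometric_hahn_banach_closed_point hKconv hKc.isClosed hxK
    set w : Fin d → ℝ := fun i => f (EuclideanSpace.single i 1) with hw
    have hL : ∀ y, f y = ∑ i, w i * y i := by
      intro y
      have hy : y = ∑ i, y i • EuclideanSpace.single i (1 : ℝ) := by
        ext j
        simp [Pi.single_apply]
      conv_lhs => rw [hy]
      simp [hw, mul_comm]
    obtain ⟨M1, M2⟩ := moments hKc μ Sig hμ hcov f w hL (u - f μ)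
    set c := u - f μ with hc
    have eZ : ∀ y, u - f y = -(f (y - μ) - c) := fun y => by rw [map_sub, hc]; ring
    have I1 : ∫ y in K, (u - f y) = c * volume.real K := by
      simp only [eZ]
      rw [integral_neg, M1]; ring
    have I2 : ∫ y in K, (u - f y) ^ 2 = volume.real K * (w ⬝ᵥ Sig.mulVec w) +
        c ^ 2 * volume.real K := by
      simp only [eZ, neg_sq]
      exact M2
    have hpos : 0 < ∫ y in K, (u - f y) := by
      obtain ⟨y0, hy0, hmin⟩ := hKc.exists_isMaxOn (hKint.mono interior_subset)
        f.continuous.continuousOn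
      have h1 : ∀ y ∈ K, u - f y0 ≤ u - f y := fun y hy => by
        have : f y ≤ f y0 := hmin hy
        linarith
      have := setIntegral_ge_of_const_le hKc.measurableSet hVtop h1
        ((by fun_prop : Continuous fun y => u - f y).continuousOn.integrableOn_compact hKc)
      have h2 := hfu y0 hy0
      have h3 : 0 < u - f y0 := by linarith
      refine lt_of_lt_of_le ?_ this
      first | exact mul_pos h3 hV | (rw [smul_eq_mul]; exact mul_pos hV h3)
    have B := berwald hd hKc hKconv hV (Z := fun y => u - f y) (by fun_prop) (by
      intro x y a b hab
      simp only [map_add, map_smul, smul_eq_mul]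
      have : u = (a + b) * u := by rw [hab, one_mul]
      linear_combination this) (fun y hy => by have := hfu y hy; linarith) hpos
    rw [I1, I2] at B
    rw [I1] at hpos
    have hcp : 0 < c := pos_of_mul_pos_left hpos hV.le
    set Q := w ⬝ᵥ Sig.mulVec w with hQ
    have hQn : 0 ≤ Q := by simpa using hSig.posSemidef.dotProduct_mulVec_nonneg w
    have B2 : (d + 2) * Q ≤ d * c ^ 2 := by
      have hV2 : 0 < volume.real K ^ 2 := by positivity
      refine le_of_mul_le_mul_left ?_ hV2
      nlinarith
    have cs := quad_cs hSig w (fun i => x i - μ i)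
    have hh : w ⬝ᵥ (fun i => x i - μ i) = f x - f μ := by
      rw [← map_sub, hL]; simp [dotProduct]
    rw [hh, ← hQ] at cs
    have hlt : c ^ 2 < (f x - f μ) ^ 2 := by
      apply pow_lt_pow_left₀ _ hcp.le (by norm_num)
      rw [hc]; linarith
    have c2 := cs.trans (mul_le_mul_of_nonneg_left hx hQn)
    rw [← mul_div_assoc, le_div_iff₀ hd'] at c2
    nlinarith
  · intro x hx
    change Real.sqrt _ ≤ Real.sqrt _
    rw [qs]
    apply Real.sqrt_le_sqrt
    set z : Fin d → ℝ := fun i => x i - μ i with hz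
    set w : Fin d → ℝ := Sig⁻¹.mulVec z with hw
    set q := z ⬝ᵥ w with hq
    let L : EuclideanSpace ℝ (Fin d) →L[ℝ] ℝ := ∑ i, w i • EuclideanSpace.proj i
    have hL : ∀ y, L y = ∑ i, w i * y i := by
      intro y
      simp [L]
    have hLz : L (x - μ) = q := by
      rw [hL, hq, dotProduct_comm]; simp [dotProduct, hz]
    have hQ : w ⬝ᵥ Sig.mulVec w = q := by rw [hw, quad_inv hSig]
    obtain ⟨M1, M2⟩ := moments hKc μ Sig hμ hcov L w hL q
    have S := star_ineq' hKc hKconv hx L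
    have e : ∀ y, L (y - x) = L (y - μ) - q := fun y => by
      rw [← hLz, ← map_sub]; congr 1; abel
    simp only [e] at S
    rw [M1, M2, hQ] at S
    have S2 : q ^ 2 ≤ d * (d + 2) * q := by
      have hV2 : 0 < volume.real K ^ 2 := by positivity
      refine le_of_mul_le_mul_left ?_ hV2
      nlinarith
    by_contra hcon
    have hcon := not_le.1 hcon
    have : 0 < (d : ℝ) * (d + 2) := by positivity
    nlinarith
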